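/- arXiv:2004.02110 — 3 statements merged into one kernel-verified Lean document; each statement's English description precedes it below -/
import Mathlib

section
/- Let Q = (I, Ω) be a finite quiver, k a field, and let M = (M_i, M_h) and N = (N_i, N_h) be finite-dimensional representations of Q over k with dimension vectors m, n : I → ℕ. Consider the linear map c_{M,N} : ⊕_{i∈I} Hom_k(M_i, N_i) → ⊕_{h∈Ω} Hom_k(M_{s(h)}, N_{t(h)}) given by (f_i)_{i∈I} ↦ (f_{t(h)} ∘ M_h − N_h ∘ f_{s(h)})_{h∈Ω}. Then the kernel of c_{M,N} is the space Hom_Q(M, N) of morphisms of representations, and dim_k ker(c_{M,N}) − dim_k coker(c_{M,N}) = Σ_{i∈I} m(i)·n(i) − Σ_{h∈Ω} m(s(h))·n(t(h)), i.e. dim Hom_Q(M,N) − dim Ext¹_Q(M,N) equals the Euler form ⟨m, n⟩. -/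
/-- For a finite quiver `Q = (I, Ω)` and finite-dimensional representations
`M = (V, Mh)`, `N = (W, Nh)` over a field `k`, the kernel of the map
`c_{M,N} : ⊕ᵢ Hom(Mᵢ, Nᵢ) → ⊕ₕ Hom(M_{s(h)}, N_{t(h)})`,
`(fᵢ) ↦ (f_{t(h)} ∘ M_h − N_h ∘ f_{s(h)})`, is `Hom_Q(M, N)`, and
`dim ker − dim coker = Σᵢ m(i)n(i) − Σₕ m(s(h))n(t(h))` (the Euler form). -/
theorem hom_ext_euler_form
    {k : Type*} [Field k] {I Ω : Type*} [Fintype I] [Fintype Ω]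
    (s t : Ω → I)
    (V W : I → Type*)
    [∀ i, AddCommGroup (V i)] [∀ i, Module k (V i)] [∀ i, FiniteDimensional k (V i)]
    [∀ i, AddCommGroup (W i)] [∀ i, Module k (W i)] [∀ i, FiniteDimensional k (W i)]
    (Mh : ∀ h, V (s h) →ₗ[k] V (t h)) (Nh : ∀ h, W (s h) →ₗ[k] W (t h))
    (c : ((i : I) → (V i →ₗ[k] W i)) →ₗ[k] ((h : Ω) → (V (s h) →ₗ[k] W (t h))))
    (hc : ∀ f h, c f h = (f (t h)).comp (Mh h) - (Nh h).comp (f (s h))) :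
    (∀ f, f ∈ LinearMap.ker c ↔
        ∀ h, (f (t h)).comp (Mh h) = (Nh h).comp (f (s h))) ∧
    (Module.finrank k (LinearMap.ker c) : ℤ) -
        Module.finrank k (((h : Ω) → (V (s h) →ₗ[k] W (t h))) ⧸ LinearMap.range c) =
      (∑ i : I, (Module.finrank k (V i) : ℤ) * Module.finrank k (W i)) -
        ∑ h : Ω, (Module.finrank k (V (s h)) : ℤ) * Module.finrank k (W (t h)) := by
  refine ⟨fun f => ?_, ?_⟩
  · simp only [LinearMap.mem_ker, funext_iff, hc, Pi.zero_apply, sub_eq_zero]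
  · have hrank := c.finrank_range_add_finrank_ker
    have hcoker := (LinearMap.range c).finrank_quotient_add_finrank
    simp only [Module.finrank_pi_fintype, Module.finrank_linearMap] at hrank hcoker
    zify at hrank hcoker
    linarith
end

section
/- Let Q = (I, Ω) be a finite quiver, ν : I → ℕ a dimension vector, (V_i)_{i∈I} finite-dimensional ℂ-vector spaces with dim_ℂ V_i = ν(i), and y ∈ E_ν(Q). Suppose the linear map c_y : ∏_{i∈I} End(V_i) → E_ν(Q), (f_i)_{i∈I} ↦ (f_{t(h)} ∘ y_h − y_h ∘ f_{s(h)})_{h∈Ω}, is surjective. Then the orbit GL(ν)·y = { g·y : g ∈ ∏_{i∈I} GL(V_i) } is an open subset of E_ν(Q) with its canonical topology as a finite-dimensional ℂ-vector space. -/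
/-- The infinitesimal action of `∏ᵢ End(Vᵢ)` is the strict derivative at `1` of the orbit map
`f ↦ (f_{t(h)} ∘ y_h ∘ f_{s(h)}⁻¹)_h`. -/
theorem hasStrictFDerivAt_quiver_orbit_map
    {𝕜 I Ω : Type*} [NontriviallyNormedField 𝕜] [Fintype I] [Fintype Ω] (s t : Ω → I)
    (V : I → Type*) [∀ i, NormedAddCommGroup (V i)] [∀ i, NormedSpace 𝕜 (V i)]
    [∀ i, CompleteSpace (V i)] (y : ∀ h, V (s h) →L[𝕜] V (t h)) :
    ∃ c : (∀ i, V i →L[𝕜] V i) →L[𝕜] (∀ h, V (s h) →L[𝕜] V (t h)),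
      (∀ f h, c f h = (f (t h)).comp (y h) - (y h).comp (f (s h))) ∧
      HasStrictFDerivAt (fun (f : ∀ i, V i →L[𝕜] V i) h =>
        (f (t h)).comp ((y h).comp (Ring.inverse (f (s h))))) c 1 := by
  have hinv (i : I) := (hasStrictFDerivAt_ringInverse (𝕜 := 𝕜)
      (1 : (V i →L[𝕜] V i)ˣ)).comp (1 : ∀ i, V i →L[𝕜] V i)
      (hasStrictFDerivAt_apply (𝕜 := 𝕜) i (1 : ∀ i, V i →L[𝕜] V i))
  have hd (h : Ω) := (hasStrictFDerivAt_apply (𝕜 := 𝕜) (t h)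
      (1 : ∀ i, V i →L[𝕜] V i)).clm_comp
        ((hasStrictFDerivAt_const (y h) (1 : ∀ i, V i →L[𝕜] V i)).clm_comp (hinv (s h)))
  refine ⟨_, fun f h => ?_, hasStrictFDerivAt_pi.2 hd⟩
  ext v
  simp [sub_eq_add_neg, add_comm]


/-- If `y ∈ E_ν(Q)` is a rigid representation of a finite quiver on
finite-dimensional complex vector spaces (i.e. the map
`c_y : ∏ᵢ End(Vᵢ) → E_ν(Q)`, `(fᵢ) ↦ (f_{t(h)} ∘ y_h − y_h ∘ f_{s(h)})` is
surjective), then the `GL(ν)`-orbit of `y` is open in `E_ν(Q)`. -/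
theorem orbit_of_rigid_representation_isOpen
    {I Ω : Type*} [Fintype I] [Fintype Ω]
    (s t : Ω → I) (ν : I → ℕ)
    (V : I → Type*) [∀ i, NormedAddCommGroup (V i)] [∀ i, NormedSpace ℂ (V i)]
    [∀ i, FiniteDimensional ℂ (V i)]
    (hdim : ∀ i, Module.finrank ℂ (V i) = ν i)
    (y : ∀ h, V (s h) →L[ℂ] V (t h))
    (hsurj : Function.Surjective fun f : ∀ i, (V i →L[ℂ] V i) =>
      fun h => (f (t h)).comp (y h) - (y h).comp (f (s h))) :
    IsOpen { z : ∀ h, V (s h) →L[ℂ] V (t h) |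
      ∃ g : ∀ i, (V i →L[ℂ] V i)ˣ,
        ∀ h, z h = ((g (t h) : V (t h) →L[ℂ] V (t h)).comp
          ((y h).comp (((g (s h))⁻¹ : (V (s h) →L[ℂ] V (s h))ˣ) :
            V (s h) →L[ℂ] V (s h)))) } := by
  have : ∀ i, CompleteSpace (V i) := fun i => FiniteDimensional.complete ℂ (V i)
  set S := { z : ∀ h, V (s h) →L[ℂ] V (t h) |
      ∃ g : ∀ i, (V i →L[ℂ] V i)ˣ,
        ∀ h, z h = ((g (t h) : V (t h) →L[ℂ] V (t h)).comp
          ((y h).comp (((g (s h))⁻¹ : (V (s h) →L[ℂ] V (s h))ˣ) :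
            V (s h) →L[ℂ] V (s h)))) }
  have hy : S ∈ nhds y := by
    obtain ⟨c, hc, hd⟩ := hasStrictFDerivAt_quiver_orbit_map s t V y
    have hrange : c.range = ⊤ := by
      refine LinearMap.range_eq_top.2 fun w => ?_
      obtain ⟨f, hf⟩ := hsurj w
      exact ⟨f, by rw [← hf]; exact funext (hc f)⟩
    have hmap := hd.map_nhds_eq_of_surj hrange
    have hone : (fun h => ((1 : ∀ i, V i →L[ℂ] V i) (t h)).comp
        ((y h).comp (Ring.inverse ((1 : ∀ i, V i →L[ℂ] V i) (s h))))) = y := by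
      ext h v
      simp
    rw [hone] at hmap
    rw [← hmap, Filter.mem_map]
    have hunits : ∀ᶠ f in nhds (1 : ∀ i, V i →L[ℂ] V i), ∀ i, IsUnit (f i) :=
      Filter.eventually_all.2 fun i =>
        (continuous_apply i).continuousAt.eventually (Units.nhds (1 : (V i →L[ℂ] V i)ˣ))
    filter_upwards [hunits] with f hf
    choose u hu using hf
    refine ⟨u, fun h => ?_⟩
    simp only [← hu, Ring.inverse_unit]
  refine isOpen_iff_mem_nhds.2 fun z ⟨g, hg⟩ => ?_
  let A : (∀ h, V (s h) →L[ℂ] V (t h)) → ∀ h, V (s h) →L[ℂ] V (t h) := fun w h =>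
    (((g (t h))⁻¹ : (V (t h) →L[ℂ] V (t h))ˣ) : V (t h) →L[ℂ] V (t h)).comp
      ((w h).comp (g (s h) : V (s h) →L[ℂ] V (s h)))
  have hcancel (i : I) (u : (V i →L[ℂ] V i)ˣ) (v : V i) :
      (u : V i →L[ℂ] V i) ((↑u⁻¹ : V i →L[ℂ] V i) v) = v :=
    DFunLike.congr_fun u.mul_inv v
  have hcancel' (i : I) (u : (V i →L[ℂ] V i)ˣ) (v : V i) :
      (↑u⁻¹ : V i →L[ℂ] V i) ((u : V i →L[ℂ] V i) v) = v :=
    DFunLike.congr_fun u.inv_mul v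
  have hA : Continuous A := by fun_prop
  have hAz : A z = y := by
    ext h v
    simp [A, hg, hcancel']
  refine Filter.mem_of_superset (hA.continuousAt.preimage_mem_nhds (hAz.symm ▸ hy)) ?_
  rintro w ⟨k, hk⟩
  refine ⟨g * k, fun h => ?_⟩
  ext v
  have h1 := congrArg (g (t h) : V (t h) →L[ℂ] V (t h))
    (DFunLike.congr_fun (hk h) ((↑(g (s h))⁻¹ : V (s h) →L[ℂ] V (s h)) v))
  simpa [A, hcancel] using h1
end

section
/- Let Q = (I, Ω) be a finite acyclic quiver and ν, μ : I → ℕ dimension vectors. Let (V_i)_{i∈I} be finite-dimensional ℂ-vector spaces with dim_ℂ V_i = ν(i) + μ(i), and let M ∈ E_{ν+μ}(Q) be a rigid representation, i.e. the linear map c_M : ∏_{i∈I} End(V_i) → E_{ν+μ}(Q), (f_i) ↦ (f_{t(h)} ∘ M_h − M_h ∘ f_{s(h)})_{h∈Ω}, is surjective. If the quiver Grassmannian Gr_μ(M) is nonempty, then Gr_μ(N) is nonempty for every representation N ∈ E_{ν+μ}(Q); equivalently, the map p_μ : E_{ν,μ} → E_{ν+μ}, (W, y) ↦ y, is surjective if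 and only if Gr_μ(M) ≠ ∅ for a rigid representation M of dimension vector ν + μ. -/
/-- The quiver Grassmannian of `N` in dimension `μ` is nonempty. -/
def HasSubrep {I Ω : Type*} {s t : Ω → I} (μ : I → ℕ) {V : I → Type*} [∀ i, AddCommGroup (V i)]
    [∀ i, Module ℂ (V i)] (N : ∀ h, V (s h) →ₗ[ℂ] V (t h)) : Prop :=
  ∃ W : ∀ i, Submodule ℂ (V i),
    (∀ i, Module.finrank ℂ (W i) = μ i) ∧ ∀ h, ∀ x ∈ W (s h), N h x ∈ W (t h)

/-- The map `c_M`, whose surjectivity is rigidity of `M`. -/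
def commutatorMap {I Ω : Type*} {s t : Ω → I} {V : I → Type*} [∀ i, AddCommGroup (V i)]
    [∀ i, Module ℂ (V i)] (M : ∀ h, V (s h) →ₗ[ℂ] V (t h)) :
    (∀ i, V i →ₗ[ℂ] V i) →ₗ[ℂ] ∀ h, V (s h) →ₗ[ℂ] V (t h) where
  toFun f h := (f (t h)).comp (M h) - (M h).comp (f (s h))
  map_add' f g := by
    funext h
    ext x
    simp only [Pi.add_apply, LinearMap.sub_apply, LinearMap.comp_apply, LinearMap.add_apply,
      map_add]
    abel
  map_smul' c f := by
    funext h
    ext x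
    simp [smul_sub]

theorem commutatorMap_add_smul {I Ω : Type*} {s t : Ω → I} {V : I → Type*}
    [∀ i, AddCommGroup (V i)] [∀ i, Module ℂ (V i)] (M N : ∀ h, V (s h) →ₗ[ℂ] V (t h)) (z : ℂ) :
    commutatorMap (M + z • N) = commutatorMap M + z • commutatorMap N := by
  refine LinearMap.ext fun f => funext fun h => LinearMap.ext fun x => ?_
  simp only [commutatorMap, LinearMap.coe_mk, AddHom.coe_mk, LinearMap.sub_apply,
    LinearMap.comp_apply, LinearMap.add_apply, Pi.add_apply, Pi.smul_apply, LinearMap.smul_apply,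
    map_add, map_smul, smul_sub]
  abel

theorem HasSubrep.of_equiv {I Ω : Type*} {s t : Ω → I} {μ : I → ℕ} {V V' : I → Type*}
    [∀ i, AddCommGroup (V i)] [∀ i, Module ℂ (V i)]
    [∀ i, AddCommGroup (V' i)] [∀ i, Module ℂ (V' i)]
    {N : ∀ h, V (s h) →ₗ[ℂ] V (t h)} {N' : ∀ h, V' (s h) →ₗ[ℂ] V' (t h)}
    (hN : HasSubrep μ N) (e : ∀ i, V i ≃ₗ[ℂ] V' i)
    (he : ∀ h x, N' h (e (s h) x) = e (t h) (N h x)) : HasSubrep μ N' := by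
  obtain ⟨W, hW, hinv⟩ := hN
  refine ⟨fun i => (W i).map (e i).toLinearMap, fun i => ?_, fun h => ?_⟩
  · rw [LinearEquiv.finrank_map_eq, hW]
  · rintro _ ⟨x, hx, rfl⟩
    exact ⟨N h x, hinv h x hx, (he h x).symm⟩

theorem commutatorMap_surjective_of_equiv {I Ω : Type*} {s t : Ω → I} {V V' : I → Type*}
    [∀ i, AddCommGroup (V i)] [∀ i, Module ℂ (V i)]
    [∀ i, AddCommGroup (V' i)] [∀ i, Module ℂ (V' i)]
    {M : ∀ h, V (s h) →ₗ[ℂ] V (t h)} {M' : ∀ h, V' (s h) →ₗ[ℂ] V' (t h)}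
    (hM : Function.Surjective (commutatorMap M)) (e : ∀ i, V i ≃ₗ[ℂ] V' i)
    (he : ∀ h x, M' h (e (s h) x) = e (t h) (M h x)) :
    Function.Surjective (commutatorMap M') := by
  intro y
  obtain ⟨f, hf⟩ := hM fun h => (e (t h)).symm.toLinearMap ∘ₗ y h ∘ₗ (e (s h)).toLinearMap
  refine ⟨fun i => (e i).toLinearMap ∘ₗ f i ∘ₗ (e i).symm.toLinearMap, ?_⟩
  refine funext fun h => LinearMap.ext fun x => ?_
  obtain ⟨x, rfl⟩ := (e (s h)).surjective x
  have key := congrArg (e (t h)) (LinearMap.congr_fun (congrFun hf h) x)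
  simpa [commutatorMap, he] using key

/-- A pencil of linear maps that is onto at `0` fails to be onto at only finitely many points. -/
theorem finite_setOf_not_surjective_add_smul {E F : Type*} [AddCommGroup E] [Module ℂ E]
    [AddCommGroup F] [Module ℂ F] [FiniteDimensional ℂ F] (L K : E →ₗ[ℂ] F)
    (hL : Function.Surjective L) :
    {z : ℂ | ¬ Function.Surjective (L + z • K)}.Finite := by
  obtain ⟨B, hB⟩ := L.exists_rightInverse_of_surjective (LinearMap.range_eq_top.2 hL)
  refine ((Module.End.finite_spectrum (K ∘ₗ B)).image fun w => -w⁻¹).subset fun z hz => ?_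
  have hz0 : z ≠ 0 := by
    rintro rfl
    exact hz (by simpa using hL)
  refine ⟨-z⁻¹, ?_, by simp⟩
  rw [← Module.End.hasEigenvalue_iff_mem_spectrum]
  by_contra hev
  apply hz
  have hinj : Function.Injective ((L + z • K) ∘ₗ B) := by
    rw [← LinearMap.ker_eq_bot, Submodule.eq_bot_iff]
    intro x hx
    by_contra hx0
    refine hev (Module.End.hasEigenvalue_of_hasEigenvector (x := x) ⟨?_, hx0⟩)
    rw [Module.End.mem_eigenspace_iff]
    have hx' : x + z • K (B x) = 0 := by
      have := LinearMap.congr_fun hB x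
      simp only [LinearMap.comp_apply, LinearMap.id_apply] at this
      simpa [this] using hx
    rw [LinearMap.comp_apply, neg_smul, eq_neg_iff_add_eq_zero,
      ← smul_right_injective F hz0 |>.eq_iff]
    simp only [smul_add, smul_smul, mul_inv_cancel₀ hz0, one_smul, smul_zero]
    rw [add_comm, hx']
  have hsurj := LinearMap.injective_iff_surjective.1 hinj
  rw [LinearMap.coe_comp] at hsurj
  exact hsurj.of_comp

section Analytic

variable {I Ω : Type*} {s t : Ω → I} {V : I → Type*}
  [∀ i, NormedAddCommGroup (V i)] [∀ i, InnerProductSpace ℂ (V i)] [∀ i, FiniteDimensional ℂ (V i)]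

open ContinuousLinearMap in
/-- A representation has a subrepresentation of dimension `μ` iff it has a compatible family of
isometric frames. -/
theorem hasSubrep_iff_exists_isometry [∀ i, CompleteSpace (V i)] (μ : I → ℕ)
    (N : ∀ h, V (s h) →L[ℂ] V (t h)) :
    HasSubrep μ (fun h => (N h).toLinearMap) ↔
      ∃ A : ∀ i, {A : EuclideanSpace ℂ (Fin (μ i)) →L[ℂ] V i // ∀ x, ‖A x‖ = ‖x‖},
        ∀ h x, N h ((A (s h)).1 x) =
          (A (t h)).1 (adjoint (A (t h)).1 (N h ((A (s h)).1 x))) := by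
  constructor
  · rintro ⟨W, hW, hinv⟩
    have b (i) := (stdOrthonormalBasis ℂ (W i)).reindex (finCongr (hW i))
    let A (i) : EuclideanSpace ℂ (Fin (μ i)) →ₗᵢ[ℂ] V i :=
      (W i).subtypeₗᵢ.comp (b i).repr.symm.toLinearIsometry
    have hA (i) (x) : A i x ∈ W i := ((b i).repr.symm x).2
    refine ⟨fun i => ⟨(A i).toContinuousLinearMap, (A i).norm_map⟩, fun h x => ?_⟩
    obtain ⟨y, hy⟩ : ∃ y, A (t h) y = N h (A (s h) x) :=
      ⟨(b (t h)).repr ⟨_, hinv h _ (hA (s h) x)⟩, by simp [A]⟩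
    have h1 : adjoint (A (t h)).toContinuousLinearMap ((A (t h)).toContinuousLinearMap y) = y :=
      DFunLike.congr_fun
        ((norm_map_iff_adjoint_comp_self (A (t h)).toContinuousLinearMap).1 (A (t h)).norm_map) y
    simp only [LinearIsometry.coe_toContinuousLinearMap] at h1 ⊢
    rw [← hy, h1]
  · rintro ⟨A, hA⟩
    refine ⟨fun i => LinearMap.range (A i).1.toLinearMap, fun i => ?_, fun h => ?_⟩
    · rw [LinearMap.finrank_range_of_inj
        ((AddMonoidHomClass.isometry_of_norm (A i).1 (A i).2).injective)]
      simp
    · rintro _ ⟨x, rfl⟩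
      exact ⟨_, (hA h x).symm⟩

theorem isClosed_setOf_hasSubrep (μ : I → ℕ) :
    IsClosed {N : ∀ h, V (s h) →L[ℂ] V (t h) | HasSubrep μ (fun h => (N h).toLinearMap)} := by
  have hV (i) : CompleteSpace (V i) := FiniteDimensional.complete ℂ _
  have hK (i) : CompactSpace {A : EuclideanSpace ℂ (Fin (μ i)) →L[ℂ] V i // ∀ x, ‖A x‖ = ‖x‖} := by
    have : ProperSpace (EuclideanSpace ℂ (Fin (μ i)) →L[ℂ] V i) :=
      FiniteDimensional.proper ℂ _
    refine isCompact_iff_compactSpace.1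
      (Metric.isCompact_of_isClosed_isBounded
        (s := {A : EuclideanSpace ℂ (Fin (μ i)) →L[ℂ] V i | ∀ x, ‖A x‖ = ‖x‖}) ?_ ?_)
    · simp only [Set.ofPred_forall]
      exact isClosed_iInter fun x => isClosed_eq (by fun_prop) continuous_const
    · refine isBounded_iff_forall_norm_le.2 ⟨1, fun A hA => ?_⟩
      exact A.opNorm_le_bound zero_le_one fun x => by rw [hA x, one_mul]
  simp only [hasSubrep_iff_exists_isometry]
  convert isClosedMap_fst_of_compactSpace
    (Y := ∀ i, {A : EuclideanSpace ℂ (Fin (μ i)) →L[ℂ] V i // ∀ x, ‖A x‖ = ‖x‖})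
    {p : (∀ h, V (s h) →L[ℂ] V (t h)) × _ | ∀ h x, p.1 h ((p.2 (s h)).1 x) =
      (p.2 (t h)).1 (ContinuousLinearMap.adjoint (p.2 (t h)).1 (p.1 h ((p.2 (s h)).1 x)))} ?_ using 1
  · ext N
    simp only [Set.mem_image, Prod.exists, exists_and_right, exists_eq_right, Set.mem_ofPred_eq]
  · simp only [Set.ofPred_forall]
    refine isClosed_iInter fun h => isClosed_iInter fun x => ?_
    have hadj : Continuous fun A : EuclideanSpace ℂ (Fin (μ (t h))) →L[ℂ] V (t h) =>
      ContinuousLinearMap.adjoint A := ContinuousLinearMap.adjoint.continuous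
    have h1 : Continuous fun p : (∀ h, V (s h) →L[ℂ] V (t h)) ×
        ∀ i, {A : EuclideanSpace ℂ (Fin (μ i)) →L[ℂ] V i // ∀ x, ‖A x‖ = ‖x‖} =>
        p.1 h ((p.2 (s h)).1 x) := by fun_prop
    refine isClosed_eq h1 ?_
    refine Continuous.clm_apply (by fun_prop) (Continuous.clm_apply (hadj.comp ?_) h1)
    fun_prop

/-- Infinitesimally rigid representations have open orbits. -/
theorem eventually_exists_equiv_of_rigid [Fintype I] [Fintype Ω] (M : ∀ h, V (s h) →L[ℂ] V (t h))
    (hM : Function.Surjective (commutatorMap fun h => (M h).toLinearMap)) :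
    ∀ᶠ N in nhds M, ∃ e : ∀ i, V i ≃ₗ[ℂ] V i, ∀ h x, N h (e (s h) x) = e (t h) (M h x) := by
  have hV (i) : CompleteSpace (V i) := FiniteDimensional.complete ℂ _
  let Φ (g : ∀ i, V i →L[ℂ] V i) (h : Ω) : V (s h) →L[ℂ] V (t h) :=
    (g (t h)).comp ((M h).comp (Ring.inverse (g (s h))))
  let Φ' : (∀ i, V i →L[ℂ] V i) →L[ℂ] ∀ h, V (s h) →L[ℂ] V (t h) :=
    ContinuousLinearMap.pi fun h =>
      ((ContinuousLinearMap.compL ℂ _ _ _).flip (M h)).comp (ContinuousLinearMap.proj (t h)) -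
      ((ContinuousLinearMap.compL ℂ _ _ _) (M h)).comp (ContinuousLinearMap.proj (s h))
  have hΦ1 : Φ 1 = M := by
    funext h
    ext x
    simp [Φ]
  have hΦ : HasStrictFDerivAt Φ Φ' 1 := by
    refine hasStrictFDerivAt_pi.2 fun h => ?_
    have hs : HasStrictFDerivAt (fun g : ∀ i, V i →L[ℂ] V i => g (s h))
      (ContinuousLinearMap.proj (R := ℂ) (s h)) 1 := hasStrictFDerivAt_apply _ _
    have ht : HasStrictFDerivAt (fun g : ∀ i, V i →L[ℂ] V i => g (t h))
      (ContinuousLinearMap.proj (R := ℂ) (t h)) 1 := hasStrictFDerivAt_apply _ _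
    have hinv : HasStrictFDerivAt (fun g : ∀ i, V i →L[ℂ] V i => Ring.inverse (g (s h)))
        _ 1 :=
      (hasStrictFDerivAt_ringInverse (𝕜 := ℂ) (1 : (V (s h) →L[ℂ] V (s h))ˣ)).comp
        (1 : ∀ i, V i →L[ℂ] V i) hs
    have hc := ht.clm_comp ((hasStrictFDerivAt_const (M h) _).clm_comp hinv)
    refine hc.congr_fderiv ?_
    ext f x
    simp
    abel
  have hsurj : Function.Surjective Φ' := by
    intro y
    obtain ⟨f, hf⟩ := hM fun h => (y h).toLinearMap
    refine ⟨fun i => (f i).toContinuousLinearMap, ?_⟩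
    funext h
    ext x
    simpa [Φ', commutatorMap] using LinearMap.congr_fun (congrFun hf h) x
  have hunit : ∀ᶠ g : ∀ i, V i →L[ℂ] V i in nhds 1, ∀ i, IsUnit (g i) := by
    refine Filter.eventually_all.2 fun i => ?_
    exact (continuous_apply i).continuousAt.eventually
      (Units.isOpen.mem_nhds (x := (1 : ∀ i, V i →L[ℂ] V i) i) isUnit_one)
  have hmap := hΦ.map_nhds_eq_of_surj (LinearMap.range_eq_top.2 hsurj)
  rw [hΦ1] at hmap
  rw [← hmap, Filter.eventually_map]
  filter_upwards [hunit] with g hg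
  choose u hu using hg
  refine ⟨fun i => (ContinuousLinearEquiv.ofUnit (u i)).toLinearEquiv, fun h x => ?_⟩
  have h1 : (Ring.inverse (g (s h))) (g (s h) x) = x := by
    rw [← mul_apply_eq_comp, Ring.inverse_mul_cancel _ (hu (s h) ▸ (u (s h)).isUnit)]
    rfl
  have he (i) (x) : (ContinuousLinearEquiv.ofUnit (u i)).toLinearEquiv x = g i x :=
    DFunLike.congr_fun (hu i) x
  simp [Φ, he, h1]

theorem HasSubrep.of_rigid [Fintype I] [Fintype Ω] {μ : I → ℕ} {M : ∀ h, V (s h) →ₗ[ℂ] V (t h)}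
    (hrigid : Function.Surjective (commutatorMap M)) (hM : HasSubrep μ M)
    (N : ∀ h, V (s h) →ₗ[ℂ] V (t h)) : HasSubrep μ N := by
  let P (z : ℂ) : ∀ h, V (s h) →ₗ[ℂ] V (t h) := M + z • (N - M)
  let P' (z : ℂ) (h : Ω) : V (s h) →L[ℂ] V (t h) :=
    (M h).toContinuousLinearMap + z • (N h - M h).toContinuousLinearMap
  have hPP (z) : (fun h => (P' z h).toLinearMap) = P z := by
    funext h
    ext x
    simp [P, P']
  have hcont : Continuous P' := by fun_prop
  have hclosed : IsClosed {z | HasSubrep μ (P z)} := by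
    have := (isClosed_setOf_hasSubrep (s := s) (t := t) (V := V) μ).preimage hcont
    simpa only [Set.preimage_ofPred_eq, hPP] using this
  let R : Set ℂ := {z | ¬ Function.Surjective (commutatorMap (P z))}
  have hR : R.Finite := by
    simp only [R, P, commutatorMap_add_smul]
    exact finite_setOf_not_surjective_add_smul _ _ hrigid
  have hconn : IsPreconnected Rᶜ :=
    (hR.countable.isConnected_compl_of_one_lt_rank (by simp)).isPreconnected
  have hopen : IsOpen {z | z ∈ Rᶜ ∧ HasSubrep μ (P z)} := by
    refine isOpen_iff_mem_nhds.2 fun z ⟨hzR, hz⟩ => ?_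
    have hz' : Function.Surjective (commutatorMap fun h => (P' z h).toLinearMap) := by
      rw [hPP]
      exact not_not.1 hzR
    filter_upwards [hR.isClosed.isOpen_compl.mem_nhds hzR,
      hcont.continuousAt.eventually (eventually_exists_equiv_of_rigid (P' z) hz')] with w hw hiso
    obtain ⟨e, he⟩ := hiso
    refine ⟨hw, ?_⟩
    rw [← hPP] at hz ⊢
    exact hz.of_equiv e he
  have hsub : Rᶜ ⊆ {z | z ∈ Rᶜ ∧ HasSubrep μ (P z)} := by
    refine hconn.subset_of_closure_inter_subset hopen ⟨0, ?_, ?_, ?_⟩ ?_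
    · simpa [R, P] using hrigid
    · simpa [R, P] using hrigid
    · simpa [P] using hM
    · rintro z ⟨hz, hzR⟩
      exact ⟨hzR, closure_minimal (fun w hw => hw.2) hclosed hz⟩
  have hP1 : HasSubrep μ (P 1) :=
    closure_minimal (fun z hz => (hsub hz).2) hclosed (hR.countable.dense_compl ℂ 1)
  rwa [show P 1 = N by simp [P]] at hP1

end Analytic


/-- For a finite acyclic quiver (acyclicity witnessed by a grading `ord` with
`ord (s h) < ord (t h)` for every arrow `h`) and a rigid representation `M` of
dimension vector `ν + μ`, the quiver Grassmannian `Gr_μ(M)` is nonempty if and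
only if `Gr_μ(N)` is nonempty for every representation `N` of the same
dimension vector; i.e. `p_μ : E_{ν,μ} → E_{ν+μ}` is surjective iff
`Gr_μ(M) ≠ ∅` for a rigid `M`. -/
theorem quiver_grassmannian_nonempty_iff_all_nonempty_of_rigid
    {I Ω : Type*} [Fintype I] [Fintype Ω]
    (s t : Ω → I) (ord : I → ℕ) (hacyclic : ∀ h, ord (s h) < ord (t h))
    (ν μ : I → ℕ)
    (V : I → Type*) [∀ i, AddCommGroup (V i)] [∀ i, Module ℂ (V i)]
    [∀ i, FiniteDimensional ℂ (V i)]
    (hdim : ∀ i, Module.finrank ℂ (V i) = ν i + μ i)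
    (M : ∀ h, V (s h) →ₗ[ℂ] V (t h))
    (hrigid : Function.Surjective fun f : ∀ i, (V i →ₗ[ℂ] V i) =>
      fun h => (f (t h)).comp (M h) - (M h).comp (f (s h))) :
    (∃ W : ∀ i, Submodule ℂ (V i),
        (∀ i, Module.finrank ℂ (W i) = μ i) ∧
        ∀ h, ∀ x ∈ W (s h), M h x ∈ W (t h)) ↔
    (∀ N : ∀ h, V (s h) →ₗ[ℂ] V (t h),
      ∃ W : ∀ i, Submodule ℂ (V i),
        (∀ i, Module.finrank ℂ (W i) = μ i) ∧
        ∀ h, ∀ x ∈ W (s h), N h x ∈ W (t h)) := by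
  refine ⟨fun hM N => ?_, fun hall => hall M⟩
  let e (i : I) : V i ≃ₗ[ℂ] EuclideanSpace ℂ (Fin (Module.finrank ℂ (V i))) :=
    LinearEquiv.ofFinrankEq _ _ (by simp)
  let conj (L : ∀ h, V (s h) →ₗ[ℂ] V (t h)) (h : Ω) :=
    (e (t h)).toLinearMap ∘ₗ L h ∘ₗ (e (s h)).symm.toLinearMap
  have hconj (L h x) : conj L h (e (s h) x) = e (t h) (L h x) := by simp [conj]
  have hM' : HasSubrep μ (conj M) := HasSubrep.of_equiv (N := M) hM e (hconj M)
  have hN' := HasSubrep.of_rigid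
    (commutatorMap_surjective_of_equiv (M := M) hrigid e (hconj M)) hM' (conj N)
  exact hN'.of_equiv (fun i => (e i).symm) fun h x => by simp [conj]
end
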